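/- Let k ≥ 2, let a_1,…,a_k be nonnegative integers with at least one a_j strictly positive, and let (x_1,…,x_{k−1}) ∈ [0,1]^{k−1} be a point at which θ_s^k(x_s,…,x_{k−1}; a) ≥ 0 for every s = 1,…,k−1. Define A(a; x) = a_1 + Σ_{ℓ=1}^{k−1} a_{ℓ+1}·α_{ℓ,1}(x_1,…,x_ℓ) and B(a; x) = a_1 + Σ_{ℓ=1}^{k−1} a_{ℓ+1}·β_{ℓ,1}(x_1,…,x_ℓ). Then A(a; x)·B(a; x) + (2/9)·(A(a; x) − B(a; x))^2 > 0. -/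

import Mathlib

open Finset

/-- The 2×2 matrix `R(x)` with rows `(1−x, x)` and `(x, 1−x)`. -/
noncomputable def Rm (x : ℝ) : Matrix (Fin 2) (Fin 2) ℝ := !![1 - x, x; x, 1 - x]

/-- The 2×2 matrix `T` with rows `(1, −1)` and `(0, 1)`. -/
noncomputable def Tm : Matrix (Fin 2) (Fin 2) ℝ := !![1, -1; 0, 1]

/-- Auxiliary product: `Maux x q n = R(x_{q+n})·T ⋯ R(x_q)·T`. -/
noncomputable def Maux (x : ℕ → ℝ) (q : ℕ) : ℕ → Matrix (Fin 2) (Fin 2) ℝ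
  | 0 => Rm (x q) * Tm
  | n + 1 => Rm (x (q + n + 1)) * Tm * Maux x q n

/-- `Mpq x p q = M_{p,q}(x_q,…,x_p) = R(x_p)·T·R(x_{p−1})·T ⋯ R(x_q)·T` (for `q ≤ p`). -/
noncomputable def Mpq (x : ℕ → ℝ) (p q : ℕ) : Matrix (Fin 2) (Fin 2) ℝ := Maux x q (p - q)

/-- `α_{p,q} = (M_{p,q})₂₂`. -/
noncomputable def alphaPQ (x : ℕ → ℝ) (p q : ℕ) : ℝ := Mpq x p q 1 1

/-- `β_{p,q} = (M_{p,q})₂₁`. -/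
noncomputable def betaPQ (x : ℕ → ℝ) (p q : ℕ) : ℝ := Mpq x p q 1 0

/-- `γ_{p,q} = (M_{p,q})₁₂`. -/
noncomputable def gammaPQ (x : ℕ → ℝ) (p q : ℕ) : ℝ := Mpq x p q 0 1

/-- `δ_{p,q} = (M_{p,q})₁₁`. -/
noncomputable def deltaPQ (x : ℕ → ℝ) (p q : ℕ) : ℝ := Mpq x p q 0 0

/-- `y_{p,q} = α_{p,q} − β_{p,q}`. -/
noncomputable def yPQ (x : ℕ → ℝ) (p q : ℕ) : ℝ := alphaPQ x p q - betaPQ x p q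

/-- `w_{p,q} = α_{p,q} + β_{p,q}`. -/
noncomputable def wPQ (x : ℕ → ℝ) (p q : ℕ) : ℝ := alphaPQ x p q + betaPQ x p q

/-- `θ_s^k(x_s,…,x_{k−1}; a) = a_s + Σ_{j=s}^{k−1} a_{j+1}·y_{j,s}`
(for `k = s` this is just `a_s`). -/
noncomputable def theta (x a : ℕ → ℝ) (k s : ℕ) : ℝ :=
  a s + ∑ j ∈ Finset.Icc s (k - 1), a (j + 1) * yPQ x j s

theorem Maux_succ_right (x : ℕ → ℝ) (q n : ℕ) :
    Maux x q (n + 1) = Maux x (q + 1) n * (Rm (x q) * Tm) := by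
  induction n with
  | zero => simp [Maux]
  | succ n ih =>
    rw [Maux, ih, Maux, ← Matrix.mul_assoc]
    congr 5
    omega

theorem Mpq_eq_mul (x : ℕ → ℝ) {p q : ℕ} (h : q + 1 ≤ p) :
    Mpq x p q = Mpq x p (q + 1) * (Rm (x q) * Tm) := by
  obtain ⟨n, rfl⟩ := Nat.exists_eq_add_of_le h
  rw [Mpq, Mpq, show q + 1 + n - q = n + 1 by omega, show q + 1 + n - (q + 1) = n by omega,
    Maux_succ_right]

theorem yPQ_self (x : ℕ → ℝ) (q : ℕ) : yPQ x q q = (3 * (1 - 2 * x q) - 1) / 2 := by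
  simp [yPQ, alphaPQ, betaPQ, Mpq, Maux, Rm, Tm, Matrix.mul_apply, Fin.sum_univ_two]
  ring

theorem wPQ_self (x : ℕ → ℝ) (q : ℕ) : wPQ x q q = (1 + (1 - 2 * x q)) / 2 := by
  simp [wPQ, alphaPQ, betaPQ, Mpq, Maux, Rm, Tm, Matrix.mul_apply, Fin.sum_univ_two]
  ring

theorem yPQ_eq (x : ℕ → ℝ) {p q : ℕ} (h : q + 1 ≤ p) :
    yPQ x p q = (3 * (1 - 2 * x q) * yPQ x p (q + 1) - wPQ x p (q + 1)) / 2 := by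
  simp [yPQ, wPQ, alphaPQ, betaPQ, Mpq_eq_mul x h, Rm, Tm, Matrix.mul_apply, Fin.sum_univ_two]
  ring

theorem wPQ_eq (x : ℕ → ℝ) {p q : ℕ} (h : q + 1 ≤ p) :
    wPQ x p q = (wPQ x p (q + 1) + (1 - 2 * x q) * yPQ x p (q + 1)) / 2 := by
  simp [yPQ, wPQ, alphaPQ, betaPQ, Mpq_eq_mul x h, Rm, Tm, Matrix.mul_apply, Fin.sum_univ_two]
  ring

/-- The analogue of `theta` with `w_{j,s}` in place of `y_{j,s}`. -/
noncomputable def omegaSum (x a : ℕ → ℝ) (k s : ℕ) : ℝ :=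
  a s + ∑ j ∈ Finset.Icc s (k - 1), a (j + 1) * wPQ x j s

theorem sum_Icc_eq_add_sum_Icc_succ (f : ℕ → ℝ) {m n : ℕ} (h : m ≤ n) :
    ∑ j ∈ Finset.Icc m n, f j = f m + ∑ j ∈ Finset.Icc (m + 1) n, f j := by
  rw [← Finset.insert_Icc_add_one_left_eq_Icc h, Finset.sum_insert (by simp)]

theorem sum_mul_yPQ (x a : ℕ → ℝ) {k s : ℕ} (h : s ≤ k - 1) :
    ∑ j ∈ Finset.Icc s (k - 1), a (j + 1) * yPQ x j s =
      (3 * (1 - 2 * x s) * theta x a k (s + 1) - omegaSum x a k (s + 1)) / 2 := by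
  have key : ∑ j ∈ Finset.Icc (s + 1) (k - 1), a (j + 1) * yPQ x j s =
      (3 * (1 - 2 * x s) * ∑ j ∈ Finset.Icc (s + 1) (k - 1), a (j + 1) * yPQ x j (s + 1)
        - ∑ j ∈ Finset.Icc (s + 1) (k - 1), a (j + 1) * wPQ x j (s + 1)) / 2 := by
    rw [Finset.mul_sum, ← Finset.sum_sub_distrib, Finset.sum_div]
    refine Finset.sum_congr rfl fun j hj => ?_
    rw [yPQ_eq x (Finset.mem_Icc.mp hj).1]
    ring
  rw [sum_Icc_eq_add_sum_Icc_succ _ h, key, yPQ_self, theta, omegaSum]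
  ring

theorem sum_mul_wPQ (x a : ℕ → ℝ) {k s : ℕ} (h : s ≤ k - 1) :
    ∑ j ∈ Finset.Icc s (k - 1), a (j + 1) * wPQ x j s =
      (omegaSum x a k (s + 1) + (1 - 2 * x s) * theta x a k (s + 1)) / 2 := by
  have key : ∑ j ∈ Finset.Icc (s + 1) (k - 1), a (j + 1) * wPQ x j s =
      (∑ j ∈ Finset.Icc (s + 1) (k - 1), a (j + 1) * wPQ x j (s + 1)
        + (1 - 2 * x s) *
          ∑ j ∈ Finset.Icc (s + 1) (k - 1), a (j + 1) * yPQ x j (s + 1)) / 2 := by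
    rw [Finset.mul_sum, ← Finset.sum_add_distrib, Finset.sum_div]
    refine Finset.sum_congr rfl fun j hj => ?_
    rw [wPQ_eq x (Finset.mem_Icc.mp hj).1]
    ring
  rw [sum_Icc_eq_add_sum_Icc_succ _ h, key, wPQ_self, theta, omegaSum]
  ring

/-- If `θ_s ≥ 0`, then `ω_s` dominates `(2/3)(a_s + ω_{s+1})`. -/
theorem le_omegaSum (x a : ℕ → ℝ) {k s : ℕ} (h : s ≤ k - 1) (hθ : 0 ≤ theta x a k s) :
    2 / 3 * (a s + omegaSum x a k (s + 1)) ≤ omegaSum x a k s := by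
  rw [theta, sum_mul_yPQ x a h] at hθ
  rw [omegaSum.eq_def x a k s, sum_mul_wPQ x a h]
  linarith

theorem omegaSum_nonneg_and_pos (x a : ℕ → ℝ) (ha : ∀ j, 0 ≤ a j) {k : ℕ} (hk : 1 ≤ k) {s : ℕ}
    (hs : s ≤ k) (hθ : ∀ i, s ≤ i → i ≤ k - 1 → 0 ≤ theta x a k i) :
    0 ≤ omegaSum x a k s ∧ ∀ j, s ≤ j → j ≤ k → 0 < a j → 0 < omegaSum x a k s := by
  induction hs using Nat.decreasingInduction with
  | self =>
    have h : omegaSum x a k k = a k := by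
      rw [omegaSum, Finset.Icc_eq_empty (by omega), Finset.sum_empty, add_zero]
    rw [h]
    refine ⟨ha k, fun j hj hjk hpos => ?_⟩
    rwa [le_antisymm hjk hj] at hpos
  | of_succ s hs ih =>
    obtain ⟨h0, hpos⟩ := ih fun i hi => hθ i (by omega)
    have hle := le_omegaSum x a (show s ≤ k - 1 by omega) (hθ s le_rfl (by omega))
    have has := ha s
    refine ⟨by linarith, fun j hj hjk hj0 => ?_⟩
    rcases hj.eq_or_lt with rfl | hlt
    · linarith
    · linarith [hpos j hlt hjk hj0]

/-- Positivity of the determinant term `A·B + (2/9)(A−B)²` under nonnegative vertical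
eigenvalues, for a nonzero weight of nonnegative integers. -/
theorem stmt2 (k : ℕ) (hk : 2 ≤ k) (a : ℕ → ℕ)
    (ha : ∃ j, 1 ≤ j ∧ j ≤ k ∧ 0 < a j)
    (x : ℕ → ℝ) (hx : ∀ i, 1 ≤ i → i ≤ k - 1 → x i ∈ Set.Icc (0 : ℝ) 1)
    (hθ : ∀ s, 1 ≤ s → s ≤ k - 1 → 0 ≤ theta x (fun j => (a j : ℝ)) k s)
    (A B : ℝ)
    (hA : A = (a 1 : ℝ) + ∑ l ∈ Finset.Icc 1 (k - 1), (a (l + 1) : ℝ) * alphaPQ x l 1)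
    (hB : B = (a 1 : ℝ) + ∑ l ∈ Finset.Icc 1 (k - 1), (a (l + 1) : ℝ) * betaPQ x l 1) :
    0 < A * B + (2 / 9) * (A - B) ^ 2 := by
  set b : ℕ → ℝ := fun j => (a j : ℝ) with hb
  have hb0 : ∀ j, 0 ≤ b j := fun j => Nat.cast_nonneg _
  obtain ⟨hω, hωpos⟩ := omegaSum_nonneg_and_pos x b hb0 (by omega : 1 ≤ k) hk
    fun i hi => hθ i (by omega)
  have hθ1 := hθ 1 le_rfl (by omega)
  have hy := sum_mul_yPQ x b (show 1 ≤ k - 1 by omega)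
  have hw := sum_mul_wPQ x b (show 1 ≤ k - 1 by omega)
  rw [theta, hy] at hθ1
  have hsub : A - B = ∑ j ∈ Finset.Icc 1 (k - 1), b (j + 1) * yPQ x j 1 := by
    simp only [hA, hB, hb, yPQ, mul_sub, Finset.sum_sub_distrib]
    ring
  have hadd : A + B = 2 * b 1 + ∑ j ∈ Finset.Icc 1 (k - 1), b (j + 1) * wPQ x j 1 := by
    simp only [hA, hB, hb, wPQ, mul_add, Finset.sum_add_distrib]
    ring
  rw [hy] at hsub
  rw [hw] at hadd
  have hpos : 0 < b 1 + omegaSum x b k 2 := by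
    obtain ⟨j, hj, hjk, hj0⟩ := ha
    have hbj : 0 < b j := Nat.cast_pos.mpr hj0
    rcases hj.eq_or_lt with rfl | hlt
    · linarith
    · linarith [hωpos j hlt hjk hbj, hb0 1]
  have h1 : 0 < 3 * (A + B) - (A - B) := by
    rw [hadd, hsub]
    linarith [hb0 1]
  have h2 : 0 < 3 * (A + B) + (A - B) := by
    rw [hadd, hsub]
    linarith [hb0 1]
  linarith [mul_pos h1 h2]
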